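/- arXiv:2507.03824 — 2 statements merged into one kernel-verified Lean document; each statement's English description precedes it below -/
import Mathlib

section
/- For |q| < 1, the third order mock theta function ω(q²) satisfies ω(q²) = q^{-1}ν(-q) - v(q²), where ω(q) := ∑_{n≥0} q^{2n(n+1)}/(q;q²)²_{n+1}, ν(q) := ∑_{n≥0} q^{n²+n}/(-q;q²)_{n+1}, and v(q) := q^{-1/2} ∏_{n≥1} (1 - q^{2n})/(1 - q^{2n-1})². -/
open Filter Topology

/-- the finite `q`-Pochhammer symbol `(z; p)_k` -/
noncomputable def poch (z p : ℂ) (k : ℕ) : ℂ := ∏ j ∈ Finset.range k, (1 - z * p ^ j)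

/-- the Gaussian binomial `[n+m, n]` -/
noncomputable def gbin (p : ℂ) (n m : ℕ) : ℂ := poch p p (n + m) / (poch p p n * poch p p m)

lemma fac_ne {x : ℂ} (hx : ‖x‖ < 1) : 1 - x ≠ 0 := by
  intro h
  have : x = 1 := (sub_eq_zero.mp h).symm
  rw [this] at hx
  simp at hx

lemma norm_mul_pow_lt {z p : ℂ} (hz : ‖z‖ < 1) (hp : ‖p‖ < 1) (j : ℕ) : ‖z * p ^ j‖ < 1 := by
  rw [norm_mul, norm_pow]
  calc ‖z‖ * ‖p‖ ^ j ≤ ‖z‖ * 1 := by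
        gcongr
        exact pow_le_one₀ (norm_nonneg _) hp.le
    _ < 1 := by simpa using hz

lemma poch_ne {z p : ℂ} (hz : ‖z‖ < 1) (hp : ‖p‖ < 1) (k : ℕ) : poch z p k ≠ 0 :=
  Finset.prod_ne_zero_iff.mpr fun j _ => fac_ne (norm_mul_pow_lt hz hp j)

lemma poch_succ (z p : ℂ) (k : ℕ) : poch z p (k + 1) = poch z p k * (1 - z * p ^ k) :=
  Finset.prod_range_succ _ _

lemma poch_zero (z p : ℂ) : poch z p 0 = 1 := rfl

lemma poch_lim {z p : ℂ} (hz : ‖z‖ < 1) (hp : ‖p‖ < 1) :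
    ∃ L : ℂ, L ≠ 0 ∧ HasProd (fun j : ℕ => 1 - z * p ^ j) L ∧
      Tendsto (poch z p) atTop (𝓝 L) := by
  have hs : Summable (fun j : ℕ => ‖-(z * p ^ j)‖) := by
    simp only [norm_neg, norm_mul, norm_pow]
    exact (summable_geometric_of_lt_one (norm_nonneg _) hp).mul_left _
  have hm := multipliable_one_add_of_summable hs
  have hne := tprod_one_add_ne_zero_of_summable (f := fun j : ℕ => -(z * p ^ j))
    (fun j => by simpa [sub_eq_add_neg] using fac_ne (norm_mul_pow_lt hz hp j)) hs
  have hh := hm.hasProd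
  simp only [← sub_eq_add_neg] at hh hne
  exact ⟨_, hne, hh, hh.tendsto_prod_nat⟩

lemma seq_bdd {u : ℕ → ℂ} {L : ℂ} (h : Tendsto u atTop (𝓝 L)) :
    ∃ C : ℝ, 0 < C ∧ ∀ n, ‖u n‖ ≤ C := by
  obtain ⟨C, hC, h⟩ := (Metric.isBounded_range_of_tendsto u h).exists_pos_norm_le
  exact ⟨C, hC, fun n => h _ ⟨n, rfl⟩⟩

lemma poch_inv_bdd {z p : ℂ} (hz : ‖z‖ < 1) (hp : ‖p‖ < 1) :
    ∃ C : ℝ, 0 < C ∧ ∀ n, ‖(poch z p n)⁻¹‖ ≤ C := by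
  obtain ⟨L, hL, -, h⟩ := poch_lim hz hp
  exact seq_bdd (h.inv₀ hL)

lemma gbin_bdd {p : ℂ} (hp : ‖p‖ < 1) : ∃ C : ℝ, 0 < C ∧ ∀ n m, ‖gbin p n m‖ ≤ C := by
  obtain ⟨L, hL, -, h⟩ := poch_lim hp hp
  obtain ⟨A, hA, hA'⟩ := seq_bdd h
  obtain ⟨B, hB, hB'⟩ := poch_inv_bdd hp hp
  refine ⟨A * (B * B), by positivity, fun n m => ?_⟩
  rw [gbin, div_eq_mul_inv, mul_inv, norm_mul, norm_mul]
  gcongr <;> first | exact hA' _ | exact hB' _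

lemma gbin_zero_left {p : ℂ} (hp : ‖p‖ < 1) (m : ℕ) : gbin p 0 m = 1 := by
  simp [gbin, poch_zero, poch_ne hp hp m]

lemma gbin_zero_right {p : ℂ} (hp : ‖p‖ < 1) (m : ℕ) : gbin p m 0 = 1 := by
  simp [gbin, poch_zero, poch_ne hp hp m]

lemma gbin_pascal {p : ℂ} (hp : ‖p‖ < 1) (n m : ℕ) :
    gbin p (n + 1) (m + 1) = gbin p n (m + 1) + p ^ (n + 1) * gbin p (n + 1) m := by
  have h1 := poch_ne hp hp n
  have h2 := poch_ne hp hp m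
  have h3 : 1 - p * p ^ n ≠ 0 := fac_ne (norm_mul_pow_lt hp hp n)
  have h4 : 1 - p * p ^ m ≠ 0 := fac_ne (norm_mul_pow_lt hp hp m)
  have e1 : n + 1 + (m + 1) = (n + m + 1) + 1 := by ring
  have e2 : n + (m + 1) = (n + m) + 1 := by ring
  have e3 : n + 1 + m = (n + m) + 1 := by ring
  simp only [gbin, e1, e2, e3, poch_succ]
  field_simp
  ring

lemma gbin_symm (p : ℂ) (n m : ℕ) : gbin p n m = gbin p m n := by
  simp only [gbin, add_comm n m, mul_comm]

/-- `(1 - p^{m+2}) [n+m+3, n+1]` in terms of level `m`. -/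
lemma gbin_rec {p : ℂ} (hp : ‖p‖ < 1) (n m : ℕ) :
    (1 - p ^ (m + 1)) * gbin p n (m + 1) = gbin p n m - p ^ (n + m + 1) * gbin p n m := by
  have h1 := poch_ne hp hp n
  have h2 := poch_ne hp hp m
  have h4 : 1 - p * p ^ m ≠ 0 := fac_ne (norm_mul_pow_lt hp hp m)
  have e2 : n + (m + 1) = (n + m) + 1 := by ring
  simp only [gbin, e2, poch_succ]
  field_simp
  ring

lemma summable_pow_gbin {p x : ℂ} (hp : ‖p‖ < 1) (hx : ‖x‖ < 1) (n : ℕ) :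
    Summable fun m => x ^ m * gbin p n m := by
  obtain ⟨C, hC, h⟩ := gbin_bdd hp
  refine Summable.of_norm_bounded
    (g := fun m => ‖x‖ ^ m * C) ((summable_geometric_of_lt_one (norm_nonneg _) hx).mul_right _) ?_
  intro m
  rw [norm_mul, norm_pow]
  gcongr
  exact h _ _

lemma gbin_gen {p x : ℂ} (hp : ‖p‖ < 1) (hx : ‖x‖ < 1) (n : ℕ) :
    ∑' m, x ^ m * gbin p n m = 1 / poch x p (n + 1) := by
  induction n with
  | zero =>
    simp only [gbin_zero_left hp, mul_one, poch_succ, poch_zero, pow_zero, one_mul, zero_add]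
    rw [tsum_geometric_of_norm_lt_one hx, one_div]
  | succ n ih =>
    have s0 := summable_pow_gbin hp hx n
    have s1 := summable_pow_gbin hp hx (n + 1)
    have hne := poch_ne hx hp (n + 1)
    have hf : 1 - x * p ^ (n + 1) ≠ 0 := fac_ne (norm_mul_pow_lt hx hp (n + 1))
    rw [s0.tsum_eq_zero_add] at ih
    have key : ∑' m, x ^ m * gbin p (n + 1) m
        = 1 / poch x p (n + 1) + x * p ^ (n + 1) * ∑' m, x ^ m * gbin p (n + 1) m := by
      conv_lhs => rw [s1.tsum_eq_zero_add]
      rw [← ih, gbin_zero_right hp, gbin_zero_right hp, ← tsum_mul_left, add_assoc,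
        ← ((summable_nat_add_iff 1).2 s0).tsum_add (s1.mul_left _)]
      congr 2
      ext m
      rw [gbin_pascal hp]
      ring
    rw [poch_succ x p (n + 1), eq_div_iff (mul_ne_zero hne hf)]
    have k2 : (1 - x * p ^ (n + 1)) * ∑' m, x ^ m * gbin p (n + 1) m = 1 / poch x p (n + 1) := by
      linear_combination key
    calc _ = poch x p (n + 1) *
          ((1 - x * p ^ (n + 1)) * ∑' m, x ^ m * gbin p (n + 1) m) := by ring
      _ = 1 := by rw [k2]; field_simp

lemma gbin_tendsto {p : ℂ} (hp : ‖p‖ < 1) (m : ℕ) :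
    Tendsto (fun n => gbin p n m) atTop (𝓝 (1 / poch p p m)) := by
  obtain ⟨L, hL, -, h⟩ := poch_lim hp hp
  have h1 : Tendsto (fun n => poch p p (n + m)) atTop (𝓝 L) :=
    h.comp (tendsto_add_atTop_nat m)
  have h2 := h1.div (h.mul_const (poch p p m)) (mul_ne_zero hL (poch_ne hp hp m))
  have : L / (L * poch p p m) = 1 / poch p p m := by
    have := poch_ne hp hp m
    field_simp
  rw [this] at h2
  exact h2

/-- Euler's identity `∑ x^m / (p;p)_m = 1/(x;p)_∞`. -/
lemma euler_sum {p x L : ℂ} (hp : ‖p‖ < 1) (hx : ‖x‖ < 1) (hL : L ≠ 0)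
    (h : Tendsto (poch x p) atTop (𝓝 L)) :
    ∑' m, x ^ m * (1 / poch p p m) = 1 / L := by
  obtain ⟨C, hC, hb⟩ := gbin_bdd hp
  have t1 : Tendsto (fun n => ∑' m, x ^ m * gbin p n m) atTop
      (𝓝 (∑' m, x ^ m * (1 / poch p p m))) := by
    refine tendsto_tsum_of_dominated_convergence (bound := fun m => ‖x‖ ^ m * C)
      ((summable_geometric_of_lt_one (norm_nonneg _) hx).mul_right _)
      (fun m => (gbin_tendsto hp m).const_mul _) (Eventually.of_forall fun n m => ?_)
    rw [norm_mul, norm_pow]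
    gcongr
    exact hb _ _
  simp only [gbin_gen hp hx] at t1
  have t2 : Tendsto (fun n => 1 / poch x p (n + 1)) atTop (𝓝 (1 / L)) :=
    tendsto_const_nhds.div (h.comp (tendsto_add_atTop_nat 1)) hL
  exact tendsto_nhds_unique t1 t2

lemma summable_w {q : ℂ} (hq : ‖q‖ < 1) : Summable fun n : ℕ => ‖q‖ ^ (n ^ 2 + n) := by
  refine Summable.of_nonneg_of_le (fun n => by positivity) (fun n => ?_)
    (summable_geometric_of_lt_one (norm_nonneg _) hq)
  exact pow_le_pow_of_le_one (norm_nonneg _) hq.le (by nlinarith)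

/-- `S_m = ∑_n q^{n²+n} [n+m, n]_{q²}` -/
noncomputable def SS (q : ℂ) (m : ℕ) : ℂ := ∑' n, q ^ (n ^ 2 + n) * gbin (q ^ 2) n m

lemma sq_lt {q : ℂ} (hq : ‖q‖ < 1) : ‖q ^ 2‖ < 1 := by
  rw [norm_pow]; exact pow_lt_one₀ (norm_nonneg _) hq (by norm_num)

lemma summable_SS {q : ℂ} (hq : ‖q‖ < 1) (m : ℕ) :
    Summable fun n => q ^ (n ^ 2 + n) * gbin (q ^ 2) n m := by
  obtain ⟨C, hC, h⟩ := gbin_bdd (sq_lt hq)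
  refine Summable.of_norm_bounded
    (g := fun n => ‖q‖ ^ (n ^ 2 + n) * C) ((summable_w hq).mul_right _) ?_
  intro m
  rw [norm_mul, norm_pow]
  gcongr
  exact h _ _

lemma SS_rec {q : ℂ} (hq : ‖q‖ < 1) (m : ℕ) :
    (1 - (q ^ 2) ^ (m + 2)) * SS q (m + 2) = SS q m := by
  have hp := sq_lt hq
  have s0 := summable_SS hq m
  have s1 := summable_SS hq (m + 1)
  have e : ∀ n, (1 - (q ^ 2) ^ (m + 2)) * (q ^ (n ^ 2 + n) * gbin (q ^ 2) n (m + 2))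
      = q ^ (n ^ 2 + n) * gbin (q ^ 2) n (m + 1)
        - (q ^ 2) ^ (m + 1) * (q ^ ((n + 1) ^ 2 + (n + 1)) * gbin (q ^ 2) n (m + 1)) := by
    intro n
    have := gbin_rec hp n (m + 1)
    linear_combination q ^ (n ^ 2 + n) * this
  have s2 : Summable fun n => (q ^ ((n + 1) ^ 2 + (n + 1)) * gbin (q ^ 2) n (m + 1)) := by
    have := s1.mul_left (q ^ 2)
    obtain ⟨C, hC, h⟩ := gbin_bdd (sq_lt hq)
    refine Summable.of_norm_bounded (g := fun n : ℕ => ‖q‖ ^ ((n + 1) ^ 2 + (n + 1)) * C)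
      (((summable_nat_add_iff 1).2 (summable_w hq)).mul_right _) ?_
    intro m
    rw [norm_mul, norm_pow]
    gcongr
    exact h _ _
  unfold SS
  rw [← tsum_mul_left]
  simp only [e]
  rw [s1.tsum_sub (s2.mul_left _), s1.tsum_eq_zero_add, s0.tsum_eq_zero_add, add_sub_assoc,
    ← ((summable_nat_add_iff 1).2 s1).tsum_sub (s2.mul_left _)]
  rw [gbin_zero_left hp, gbin_zero_left hp]
  congr 2
  ext n
  have := gbin_pascal hp m n
  rw [gbin_symm _ (m + 1) (n + 1), gbin_symm _ m (n + 1), gbin_symm _ (m + 1) n] at this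
  rw [this]
  ring

lemma SS_one {q : ℂ} (hq : ‖q‖ < 1) : (1 - q ^ 2) * SS q 1 = 1 := by
  have hp := sq_lt hq
  have s : Summable fun n : ℕ => q ^ (n ^ 2 + n) := by
    refine Summable.of_norm ?_
    simpa only [norm_pow] using summable_w hq
  unfold SS
  rw [← tsum_mul_left]
  have e : ∀ n, (1 - q ^ 2) * (q ^ (n ^ 2 + n) * gbin (q ^ 2) n 1)
      = q ^ (n ^ 2 + n) - q ^ ((n + 1) ^ 2 + (n + 1)) := by
    intro n
    have := gbin_rec hp n 0
    rw [gbin_zero_right hp] at this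
    linear_combination q ^ (n ^ 2 + n) * this
  simp only [e]
  rw [s.tsum_sub ((summable_nat_add_iff 1).2 s), s.tsum_eq_zero_add]
  simp

lemma SS_odd {q : ℂ} (hq : ‖q‖ < 1) (i : ℕ) :
    SS q (2 * i + 1) = 1 / poch (q ^ 2) ((q ^ 2) ^ 2) (i + 1) := by
  have hp := sq_lt hq
  induction i with
  | zero =>
    have := SS_one hq
    have h1 := fac_ne hp
    simp only [poch_succ, poch_zero, pow_zero, one_mul, mul_one, mul_zero, zero_add]
    rw [eq_div_iff h1]
    linear_combination this
  | succ i ih =>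
    have h1 := poch_ne hp (sq_lt hp) (i + 1)
    have h2 := fac_ne (norm_mul_pow_lt hp (sq_lt hp) (i + 1))
    have := SS_rec hq (2 * i + 1)
    rw [ih, eq_div_iff h1] at this
    rw [poch_succ, eq_div_iff (mul_ne_zero h1 h2)]
    rw [show 2 * (i + 1) + 1 = 2 * i + 1 + 2 by ring]
    linear_combination this

lemma SS_even {q : ℂ} (hq : ‖q‖ < 1) (i : ℕ) :
    SS q (2 * i) = SS q 0 * (1 / poch ((q ^ 2) ^ 2) ((q ^ 2) ^ 2) i) := by
  have hp := sq_lt hq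
  induction i with
  | zero => simp [poch_zero]
  | succ i ih =>
    have h1 := poch_ne (sq_lt hp) (sq_lt hp) i
    have h2 := fac_ne (norm_mul_pow_lt (sq_lt hp) (sq_lt hp) i)
    have := SS_rec hq (2 * i)
    rw [ih, mul_one_div, eq_div_iff h1] at this
    rw [poch_succ, mul_one_div, eq_div_iff (mul_ne_zero h1 h2)]
    rw [← this, show 2 * (i + 1) = 2 * i + 2 by ring]
    ring

lemma SS_tendsto {q : ℂ} (hq : ‖q‖ < 1) :
    Tendsto (SS q) atTop (𝓝 (∑' n, q ^ (n ^ 2 + n) * (1 / poch (q ^ 2) (q ^ 2) n))) := by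
  obtain ⟨C, hC, hb⟩ := gbin_bdd (sq_lt hq)
  refine tendsto_tsum_of_dominated_convergence (bound := fun n => ‖q‖ ^ (n ^ 2 + n) * C)
    ((summable_w hq).mul_right _)
    (fun n => ?_) (Eventually.of_forall fun n m => ?_)
  · simp only [gbin_symm _ n]
    exact (gbin_tendsto (sq_lt hq) n).const_mul _
  · rw [norm_mul, norm_pow]
    gcongr
    exact hb _ _

/-- Gauss: `S_0 = (p²;p²)_∞/(p;p²)_∞`. -/
lemma SS_zero {q L1 L2 : ℂ} (hq : ‖q‖ < 1) (h1 : L1 ≠ 0) (h2 : L2 ≠ 0)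
    (t1 : Tendsto (poch ((q ^ 2) ^ 2) ((q ^ 2) ^ 2)) atTop (𝓝 L1))
    (t2 : Tendsto (poch (q ^ 2) ((q ^ 2) ^ 2)) atTop (𝓝 L2)) : SS q 0 = L1 / L2 := by
  have ht := SS_tendsto hq
  have te : Tendsto (fun i : ℕ => 2 * i) atTop atTop :=
    tendsto_atTop_mono (fun i => by simp only [id]; omega) tendsto_id
  have tod : Tendsto (fun i : ℕ => 2 * i + 1) atTop atTop :=
    tendsto_atTop_mono (fun i => by simp only [id]; omega) tendsto_id
  have a1 := ht.comp te
  have a2 := ht.comp tod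
  have b1 : Tendsto (SS q ∘ fun i : ℕ => 2 * i) atTop (𝓝 (SS q 0 * (1 / L1))) := by
    have : (SS q ∘ fun i : ℕ => 2 * i)
        = fun i => SS q 0 * (1 / poch ((q ^ 2) ^ 2) ((q ^ 2) ^ 2) i) :=
      funext fun i => SS_even hq i
    rw [this]
    exact (tendsto_const_nhds.div t1 h1).const_mul _
  have b2 : Tendsto (SS q ∘ fun i : ℕ => 2 * i + 1) atTop (𝓝 (1 / L2)) := by
    have : (SS q ∘ fun i : ℕ => 2 * i + 1)
        = fun i => 1 / poch (q ^ 2) ((q ^ 2) ^ 2) (i + 1) :=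
      funext fun i => SS_odd hq i
    rw [this]
    exact tendsto_const_nhds.div (t2.comp (tendsto_add_atTop_nat 1)) h2
  have := (tendsto_nhds_unique a1 b1).symm.trans (tendsto_nhds_unique a2 b2)
  field_simp at this ⊢
  linear_combination this

/-- `ν(-q) = ∑ q^m S_m`. -/
lemma nu_eq {q : ℂ} (hq : ‖q‖ < 1) :
    Summable (fun m => q ^ m * SS q m) ∧
    ∑' n : ℕ, q ^ (n ^ 2 + n) / poch q (q ^ 2) (n + 1) = ∑' m, q ^ m * SS q m := by
  obtain ⟨C, hC, hb⟩ := gbin_bdd (sq_lt hq)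
  have hs : Summable (Function.uncurry fun n m : ℕ =>
      q ^ (n ^ 2 + n) * (q ^ m * gbin (q ^ 2) n m)) := by
    refine Summable.of_norm_bounded
      (g := fun x : ℕ × ℕ => (‖q‖ ^ (x.1 ^ 2 + x.1)) * (‖q‖ ^ x.2 * C)) ?_ ?_
    · exact (summable_w hq).mul_of_nonneg
        ((summable_geometric_of_lt_one (norm_nonneg _) hq).mul_right C)
        (fun n => by positivity) (fun n => by positivity)
    · rintro ⟨n, m⟩
      simp only [Function.uncurry, norm_mul, norm_pow]
      gcongr
      exact hb _ _
  have e1 : ∀ m, ∑' n : ℕ, q ^ (n ^ 2 + n) * (q ^ m * gbin (q ^ 2) n m) = q ^ m * SS q m := by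
    intro m
    rw [SS, ← tsum_mul_left]
    congr 1
    ext n
    ring
  have e2 : ∀ n, ∑' m : ℕ, q ^ (n ^ 2 + n) * (q ^ m * gbin (q ^ 2) n m)
      = q ^ (n ^ 2 + n) / poch q (q ^ 2) (n + 1) := by
    intro n
    rw [tsum_mul_left, gbin_gen (sq_lt hq) hq, mul_one_div]
  constructor
  · have := hs.prod_symm.prod
    refine this.congr fun m => ?_
    exact e1 m
  · rw [← tsum_congr e1, ← tsum_congr e2]
    exact hs.tsum_comm.symm

/-- `M_N = ∑_n p^{(2N+1)n}/(p;p²)_{N+n+1}` -/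
noncomputable def MM (p : ℂ) (N : ℕ) : ℂ := ∑' n : ℕ, (p ^ (2 * N + 1)) ^ n / poch p (p ^ 2) (N + n + 1)

lemma MM_bound {p : ℂ} (hp : ‖p‖ < 1) {C : ℝ} (hb : ∀ n, ‖(poch p (p ^ 2) n)⁻¹‖ ≤ C) (N n : ℕ) :
    ‖(p ^ (2 * N + 1)) ^ n / poch p (p ^ 2) (N + n + 1)‖ ≤ ‖p‖ ^ n * C := by
  rw [div_eq_mul_inv, norm_mul]
  gcongr
  · rw [← pow_mul, norm_pow]
    exact pow_le_pow_of_le_one (norm_nonneg _) hp.le (by nlinarith)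
  · exact hb _

lemma MM_summable {p : ℂ} (hp : ‖p‖ < 1) (N : ℕ) :
    Summable fun n : ℕ => (p ^ (2 * N + 1)) ^ n / poch p (p ^ 2) (N + n + 1) := by
  obtain ⟨C, hC, hb⟩ := poch_inv_bdd hp (sq_lt hp)
  exact Summable.of_norm_bounded
    ((summable_geometric_of_lt_one (norm_nonneg _) hp).mul_right C) (MM_bound hp hb N)

lemma MM_bdd {p : ℂ} (hp : ‖p‖ < 1) : ∃ B : ℝ, ∀ N, ‖MM p N‖ ≤ B := by
  obtain ⟨C, hC, hb⟩ := poch_inv_bdd hp (sq_lt hp)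
  exact ⟨_, fun N => tsum_of_norm_bounded
    ((summable_geometric_of_lt_one (norm_nonneg _) hp).mul_right C).hasSum (MM_bound hp hb N)⟩

lemma MM_rec {p : ℂ} (hp : ‖p‖ < 1) (N : ℕ) :
    (1 - p ^ (2 * N + 1)) * MM p N
      = 1 / poch p (p ^ 2) (N + 1) + p ^ (4 * N + 4) * MM p (N + 1) := by
  have s0 := MM_summable hp N
  have s1 := MM_summable hp (N + 1)
  have key : MM p N = 1 / poch p (p ^ 2) (N + 1) +
      (p ^ (2 * N + 1) * MM p N + p ^ (4 * N + 4) * MM p (N + 1)) := by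
    unfold MM
    conv_lhs => rw [s0.tsum_eq_zero_add]
    rw [← tsum_mul_left, ← tsum_mul_left, ← (s0.mul_left _).tsum_add (s1.mul_left _)]
    congr 1
    · refine tsum_congr fun n => ?_
      have h1 := poch_ne hp (sq_lt hp) (N + n + 1)
      have h2 := fac_ne (norm_mul_pow_lt hp (sq_lt hp) (N + n + 1))
      rw [show N + (n + 1) + 1 = N + n + 1 + 1 by ring, show N + 1 + n + 1 = N + n + 1 + 1 by ring,
        poch_succ _ _ (N + n + 1)]
      field_simp
      ring
  linear_combination key

/-- `ω(p) = ∑ p^n/(p;p²)_{n+1}`. -/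
lemma omega_eq {p : ℂ} (hp : ‖p‖ < 1) :
    ∑' n : ℕ, p ^ (2 * n * (n + 1)) / poch p (p ^ 2) (n + 1) ^ 2 = MM p 0 := by
  have hpp := sq_lt hp
  obtain ⟨C, hC, hb⟩ := poch_inv_bdd hp hpp
  obtain ⟨B, hB⟩ := MM_bdd hp
  have part : ∀ N, ∑ n ∈ Finset.range N, p ^ (2 * n * (n + 1)) / poch p (p ^ 2) (n + 1) ^ 2
      = MM p 0 - p ^ (2 * N * (N + 1)) * (MM p N * (poch p (p ^ 2) N)⁻¹) := by
    intro N
    induction N with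
    | zero => simp [poch_zero]
    | succ N ih =>
      rw [Finset.sum_range_succ, ih]
      have h1 := poch_ne hp hpp N
      have h2 : 1 - p * (p ^ 2) ^ N ≠ 0 := fac_ne (norm_mul_pow_lt hp hpp N)
      have hr := MM_rec hp N
      rw [show p ^ (2 * N + 1) = p * (p ^ 2) ^ N by ring] at hr
      have hM : MM p N = (1 / poch p (p ^ 2) (N + 1) + p ^ (4 * N + 4) * MM p (N + 1)) /
          (1 - p * (p ^ 2) ^ N) := by
        rw [eq_div_iff h2, ← hr]; ring
      rw [hM, poch_succ]
      field_simp
      ring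
  have hs : Summable fun n : ℕ => p ^ (2 * n * (n + 1)) / poch p (p ^ 2) (n + 1) ^ 2 := by
    refine Summable.of_norm_bounded
      ((summable_geometric_of_lt_one (norm_nonneg _) hp).mul_right (C ^ 2)) fun n => ?_
    rw [div_eq_mul_inv, norm_mul, ← inv_pow, norm_pow, norm_pow]
    have h1 : ‖p‖ ^ (2 * n * (n + 1)) ≤ ‖p‖ ^ n :=
      pow_le_pow_of_le_one (norm_nonneg _) hp.le (by nlinarith)
    have h2 := pow_le_pow_left₀ (norm_nonneg _) (hb (n + 1)) 2
    exact mul_le_mul h1 h2 (by positivity) (by positivity)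
  have t1 := hs.hasSum.tendsto_sum_nat
  simp only [part] at t1
  have t0 : Tendsto (fun N : ℕ => p ^ (2 * N * (N + 1)) * (MM p N * (poch p (p ^ 2) N)⁻¹))
      atTop (𝓝 0) := by
    have g : Tendsto (fun N : ℕ => ‖p‖ ^ N * (B * C)) atTop (𝓝 0) := by
      simpa using (tendsto_pow_atTop_nhds_zero_of_lt_one (norm_nonneg p) hp).mul_const (B * C)
    refine squeeze_zero_norm (fun N => ?_) g
    have hB0 : 0 ≤ B := (norm_nonneg _).trans (hB 0)
    rw [norm_mul, norm_mul, norm_pow]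
    have h1 : ‖p‖ ^ (2 * N * (N + 1)) ≤ ‖p‖ ^ N :=
      pow_le_pow_of_le_one (norm_nonneg _) hp.le (by nlinarith)
    have h2 := mul_le_mul (hB N) (hb N) (norm_nonneg _) hB0
    exact mul_le_mul h1 h2 (by positivity) (by positivity)
  have t2 := t0.const_sub (MM p 0)
  rw [sub_zero] at t2
  exact tendsto_nhds_unique t1 t2

theorem omega_nu_relation (q : ℂ) (hq0 : q ≠ 0) (hq : ‖q‖ < 1) :
    ∑' n : ℕ, (q ^ 2) ^ (2 * n * (n + 1)) /
        (∏ j ∈ Finset.range (n + 1), (1 - (q ^ 2) ^ (2 * j + 1))) ^ 2 =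
      q⁻¹ * ∑' n : ℕ, (-q) ^ (n ^ 2 + n) /
          ∏ j ∈ Finset.range (n + 1), (1 + (-q) ^ (2 * j + 1)) -
        q⁻¹ * ∏' n : ℕ, (1 - q ^ (4 * (n + 1))) / (1 - q ^ (4 * (n + 1) - 2)) ^ 2 := by
  have hp := sq_lt hq
  have hpp := sq_lt hp
  obtain ⟨L1, hL1, p1, t1⟩ := poch_lim hpp hpp
  obtain ⟨L2, hL2, p2, t2⟩ := poch_lim hp hpp
  -- the product
  have hprod : ∏' n : ℕ, (1 - q ^ (4 * (n + 1))) / (1 - q ^ (4 * (n + 1) - 2)) ^ 2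
      = L1 / (L2 * L2) := by
    rw [← (p1.div₀ (p2.mul p2) (mul_ne_zero hL2 hL2)).tprod_eq]
    refine tprod_congr fun n => ?_
    rw [show 4 * (n + 1) - 2 = 4 * n + 2 by omega]
    ring
  -- omega
  have hom : ∑' n : ℕ, (q ^ 2) ^ (2 * n * (n + 1)) /
        (∏ j ∈ Finset.range (n + 1), (1 - (q ^ 2) ^ (2 * j + 1))) ^ 2 = MM (q ^ 2) 0 := by
    rw [← omega_eq hp]
    refine tsum_congr fun n => ?_
    have : ∏ j ∈ Finset.range (n + 1), (1 - (q ^ 2) ^ (2 * j + 1))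
        = poch (q ^ 2) ((q ^ 2) ^ 2) (n + 1) := by
      unfold poch
      refine Finset.prod_congr rfl fun j _ => ?_
      rw [pow_succ (q ^ 2) (2 * j), pow_mul (q ^ 2) 2 j, mul_comm]
    rw [this]
  -- nu
  have hnu : ∑' n : ℕ, (-q) ^ (n ^ 2 + n) /
          ∏ j ∈ Finset.range (n + 1), (1 + (-q) ^ (2 * j + 1)) = ∑' m, q ^ m * SS q m := by
    rw [← (nu_eq hq).2]
    refine tsum_congr fun n => ?_
    have h1 : Even (n ^ 2 + n) := by
      rw [show n ^ 2 + n = n * (n + 1) by ring]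
      exact Nat.even_mul_succ_self n
    have h2 : ∏ j ∈ Finset.range (n + 1), (1 + (-q) ^ (2 * j + 1))
        = poch q (q ^ 2) (n + 1) := by
      unfold poch
      refine Finset.prod_congr rfl fun j _ => ?_
      rw [(odd_two_mul_add_one j).neg_pow, pow_succ q (2 * j), pow_mul q 2 j, mul_comm,
        ← sub_eq_add_neg]
    rw [h1.neg_pow, h2]
  have hs := (nu_eq hq).1
  have se : Summable fun i => q ^ (2 * i) * SS q (2 * i) :=
    hs.comp_injective (i := fun i : ℕ => 2 * i) (fun a b h => by simpa using h)
  have so : Summable fun i => q ^ (2 * i + 1) * SS q (2 * i + 1) :=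
    hs.comp_injective (i := fun i : ℕ => 2 * i + 1) (fun a b h => by simpa using h)
  have split := tsum_even_add_odd (f := fun m => q ^ m * SS q m) se so
  have ev : ∑' i, q ^ (2 * i) * SS q (2 * i) = L1 / (L2 * L2) := by
    have : ∀ i, q ^ (2 * i) * SS q (2 * i)
        = SS q 0 * ((q ^ 2) ^ i * (1 / poch ((q ^ 2) ^ 2) ((q ^ 2) ^ 2) i)) := by
      intro i
      rw [SS_even hq, pow_mul]; ring
    rw [tsum_congr this, tsum_mul_left, euler_sum hpp hp hL2 t2, SS_zero hq hL1 hL2 t1 t2]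
    field_simp
  have od : ∑' i, q ^ (2 * i + 1) * SS q (2 * i + 1) = q * MM (q ^ 2) 0 := by
    rw [MM, ← tsum_mul_left]
    refine tsum_congr fun i => ?_
    rw [SS_odd hq, mul_zero, zero_add, zero_add, pow_one]
    ring
  rw [hprod, hom, hnu, ← split, ev, od]
  field_simp
  ring
end

section
/- Let q be a primitive k-th root of unity with k odd. Then ψ(-q) = (1/3) ∑_{n=0}^{k-1} ∏_{j=1}^{n}(1 + q^{2j}) · (-q)^{n+1}, where ψ(q) := ∑_{n≥1} q^{n²}/∏_{j=0}^{n-1}(1 - q^{2j+1}) converges at such q (note for k odd, -q is a primitive 2k-th root of unity and the series ψ(-q) converges). -/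
lemma aq_prod (k : ℕ) (p X : ℂ) (hp : IsPrimitiveRoot p k) (hk : Odd k) (hX : X ^ k = 1) :
    ∏ j ∈ Finset.range k, (1 + X * p ^ j) = 2 := by
  have h := X_pow_sub_C_eq_prod hp hk.pos hX
  have h2 := congrArg (Polynomial.eval (-1)) h
  simp only [Polynomial.eval_sub, Polynomial.eval_pow, Polynomial.eval_X, Polynomial.eval_C,
    Polynomial.eval_prod, hk.neg_one_pow] at h2
  have h3 : ∏ j ∈ Finset.range k, ((-1 : ℂ) - p ^ j * X)
      = ∏ j ∈ Finset.range k, ((-1) * (1 + X * p ^ j)) := by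
    apply Finset.prod_congr rfl
    intros
    ring
  rw [h3, Finset.prod_mul_distrib, Finset.prod_const, Finset.card_range, hk.neg_one_pow] at h2
  linear_combination h2

noncomputable def aqG (k : ℕ) (p X Y : ℂ) : ℂ :=
  ∑ n ∈ Finset.range k, (∏ j ∈ Finset.range n, (1 + X * p ^ j)) * (-Y) ^ n

lemma aq_shift (k : ℕ) (p X Y : ℂ) (hp : IsPrimitiveRoot p k) (hk : Odd k) (hX : X ^ k = 1)
    (hY : Y ^ k = 1) :
    ∑ n ∈ Finset.range k, (∏ j ∈ Finset.range (n + 1), (1 + X * p ^ j)) * (-Y) ^ (n + 1)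
      = aqG k p X Y - 3 := by
  have h1 := Finset.sum_range_succ
    (fun n => (∏ j ∈ Finset.range n, (1 + X * p ^ j)) * (-Y) ^ n) k
  have h2 := Finset.sum_range_succ'
    (fun n => (∏ j ∈ Finset.range n, (1 + X * p ^ j)) * (-Y) ^ n) k
  rw [h1] at h2
  simp only [aq_prod k p X hp hk hX, hk.neg_pow, hY, Finset.prod_range_zero, pow_zero] at h2
  unfold aqG
  linear_combination -h2

lemma aq_recX (k : ℕ) (p X Y : ℂ) (hp : IsPrimitiveRoot p k) (hk : Odd k) (hX : X ^ k = 1)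
    (hY : Y ^ k = 1) :
    aqG k p X Y = 3 - Y * (1 + X) * aqG k p (p * X) Y := by
  have h := aq_shift k p X Y hp hk hX hY
  have h2 : ∑ n ∈ Finset.range k, (∏ j ∈ Finset.range (n + 1), (1 + X * p ^ j)) * (-Y) ^ (n + 1)
      = -(Y * (1 + X) * aqG k p (p * X) Y) := by
    unfold aqG
    rw [Finset.mul_sum, ← Finset.sum_neg_distrib]
    apply Finset.sum_congr rfl
    intro n _
    rw [Finset.prod_range_succ', pow_zero, mul_one]
    have : ∏ j ∈ Finset.range n, (1 + X * p ^ (j + 1))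
        = ∏ j ∈ Finset.range n, (1 + p * X * p ^ j) := by
      apply Finset.prod_congr rfl
      intros
      ring
    rw [this]
    ring
  linear_combination h2 - h

lemma aq_recY (k : ℕ) (p X Y : ℂ) (hp : IsPrimitiveRoot p k) (hk : Odd k) (hX : X ^ k = 1)
    (hY : Y ^ k = 1) :
    (1 + Y) * aqG k p X Y = 3 - X * Y * aqG k p X (p * Y) := by
  have h := aq_shift k p X Y hp hk hX hY
  have h2 : ∑ n ∈ Finset.range k, (∏ j ∈ Finset.range (n + 1), (1 + X * p ^ j)) * (-Y) ^ (n + 1)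
      = -(Y * aqG k p X Y) - X * Y * aqG k p X (p * Y) := by
    unfold aqG
    rw [Finset.mul_sum, Finset.mul_sum, ← Finset.sum_neg_distrib, ← Finset.sum_sub_distrib]
    apply Finset.sum_congr rfl
    intro n _
    rw [Finset.prod_range_succ, show -(p * Y) = p * (-Y) by ring, mul_pow]
    ring
  linear_combination h2 - h

lemma aq_ne (k : ℕ) (X : ℂ) (hk : Odd k) (hX : X ^ k = 1) : 1 + X ≠ 0 := by
  intro h
  have : X = -1 := by linear_combination h
  rw [this, hk.neg_one_pow] at hX
  norm_num at hX

lemma aq_sym (k : ℕ) (p : ℂ) (hp : IsPrimitiveRoot p k) (hk : Odd k) (i : ℕ) :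
    aqG k p (p ^ i) 1 = p / p ^ i * aqG k p p (p / p ^ i) := by
  have hp0 : p ≠ 0 := hp.ne_zero hk.pos.ne'
  have hpk := hp.pow_eq_one
  induction i with
  | zero =>
    have h1 := aq_recX k p 1 1 hp hk (one_pow _) (one_pow _)
    have h2 := aq_recY k p p 1 hp hk hpk (one_pow _)
    simp only [mul_one, pow_zero, div_one] at *
    linear_combination h1 - h2
  | succ i ih =>
    have hX : (p ^ i) ^ k = 1 := by rw [← pow_mul, mul_comm, pow_mul, hpk, one_pow]
    have hX0 : p ^ i ≠ 0 := pow_ne_zero _ hp0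
    have h1 := aq_recX k p (p ^ i) 1 hp hk hX (one_pow _)
    have h2 := aq_recY k p p (1 / p ^ i) hp hk hpk (by rw [div_pow, hX, one_pow, div_one])
    have e1 : p / p ^ (i + 1) = 1 / p ^ i := by
      rw [pow_succ]; field_simp
    have e2 : p * (1 / p ^ i) = p / p ^ i := by ring
    rw [e1]
    rw [e2] at h2
    rw [ih, ← pow_succ'] at h1
    apply mul_left_cancel₀ (aq_ne k _ hk hX)
    have e3 : (1 + p ^ i) * (1 / p ^ i * aqG k p p (1 / p ^ i))
        = (1 + 1 / p ^ i) * aqG k p p (1 / p ^ i) := by field_simp; ring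
    rw [e3]
    linear_combination h1 - h2

lemma aq_main (k : ℕ) (q : ℂ) (hq : IsPrimitiveRoot q k) (hk : Odd k) :
    aqG k (q ^ 2) q 1 = q * aqG k (q ^ 2) (q ^ 2) q := by
  have hp : IsPrimitiveRoot (q ^ 2) k := hq.pow_of_coprime 2 (Nat.coprime_two_left.2 hk)
  have hq0 : q ≠ 0 := hq.ne_zero hk.pos.ne'
  obtain ⟨m, hm⟩ := hk
  have e : (q ^ 2) ^ (m + 1) = q := by
    rw [← pow_mul, show 2 * (m + 1) = k + 1 by omega, pow_succ, hq.pow_eq_one, one_mul]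
  have h := aq_sym k (q ^ 2) hp ⟨m, hm⟩ (m + 1)
  rw [e, show q ^ 2 / q = q by field_simp] at h
  exact h

noncomputable def aqT (q : ℂ) (m : ℕ) : ℂ :=
  (-q) ^ (m ^ 2) / ∏ j ∈ Finset.range m, (1 - (-q) ^ (2 * j + 1))

lemma aq_odd (q : ℂ) (j : ℕ) : (-q) ^ (2 * j + 1) = -q ^ (2 * j + 1) :=
  Odd.neg_pow ⟨j, rfl⟩ q

lemma aq_qpow (k : ℕ) (q : ℂ) (hq : IsPrimitiveRoot q k) (i : ℕ) : (q ^ i) ^ k = 1 := by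
  rw [← pow_mul, mul_comm, pow_mul, hq.pow_eq_one, one_pow]

lemma aq_Dne (k : ℕ) (q : ℂ) (hq : IsPrimitiveRoot q k) (hk : Odd k) (j : ℕ) :
    1 - (-q) ^ (2 * j + 1) ≠ 0 := by
  rw [aq_odd, sub_neg_eq_add]
  exact aq_ne k _ hk (aq_qpow k q hq _)

lemma aqT_succ (q : ℂ) (m : ℕ) :
    aqT q (m + 1) = aqT q m * ((-q) ^ (2 * m + 1) / (1 - (-q) ^ (2 * m + 1))) := by
  unfold aqT
  rw [Finset.prod_range_succ, div_mul_div_comm, ← pow_add]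
  congr 2
  ring

lemma aqT_k (k : ℕ) (q : ℂ) (hq : IsPrimitiveRoot q k) (hk : Odd k) : aqT q k = -1 / 2 := by
  have hp : IsPrimitiveRoot (q ^ 2) k := hq.pow_of_coprime 2 (Nat.coprime_two_left.2 hk)
  unfold aqT
  have h := aq_prod k (q ^ 2) q hp hk hq.pow_eq_one
  have : ∏ j ∈ Finset.range k, (1 - (-q) ^ (2 * j + 1))
      = ∏ j ∈ Finset.range k, (1 + q * (q ^ 2) ^ j) := by
    apply Finset.prod_congr rfl
    intro j _
    rw [aq_odd]
    ring
  rw [this, h, sq k, pow_mul, hk.neg_pow, hq.pow_eq_one, hk.neg_one_pow]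

lemma aqT_add (k : ℕ) (q : ℂ) (hq : IsPrimitiveRoot q k) (hk : Odd k) (m : ℕ) :
    aqT q (m + k) = (-1 / 2) * aqT q m := by
  induction m with
  | zero =>
    rw [zero_add, aqT_k k q hq hk]
    simp [aqT]
  | succ m ih =>
    rw [show m + 1 + k = m + k + 1 by ring, aqT_succ, aqT_succ, ih]
    have : (-q) ^ (2 * (m + k) + 1) = (-q) ^ (2 * m + 1) := by
      rw [show 2 * (m + k) + 1 = (2 * m + 1) + k * 2 by ring, pow_add, pow_mul _ k, hk.neg_pow,
        hq.pow_eq_one]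
      norm_num
    rw [this]
    ring

lemma aqT_mul (k : ℕ) (q : ℂ) (hq : IsPrimitiveRoot q k) (hk : Odd k) (a b : ℕ) :
    aqT q (b + 1 + a * k) = (-1 / 2) ^ a * aqT q (b + 1) := by
  induction a with
  | zero => simp
  | succ a ih =>
    rw [show b + 1 + (a + 1) * k = b + 1 + a * k + k by ring, aqT_add k q hq hk, ih]
    ring

lemma aqT_rev (k : ℕ) (q : ℂ) (hq : IsPrimitiveRoot q k) (hk : Odd k) (n m : ℕ)
    (h : m + n = k) :
    2 * aqT q m = -((∏ j ∈ Finset.range n, (1 + q * (q ^ 2) ^ j)) * (-1) ^ n) := by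
  induction n generalizing m with
  | zero =>
    obtain rfl : m = k := by omega
    rw [aqT_k m q hq hk]
    norm_num
  | succ n ih =>
    have h1 := ih (m + 1) (by omega)
    rw [aqT_succ] at h1
    have hne := aq_Dne k q hq hk m
    have hq0 : q ≠ 0 := hq.ne_zero hk.pos.ne'
    have e : q ^ (2 * m + 1) * (q * (q ^ 2) ^ n) = 1 := by
      have : q ^ (2 * m + 1) * (q * (q ^ 2) ^ n) = (q ^ k) ^ 2 := by
        rw [← h]; ring
      rw [this, hq.pow_eq_one, one_pow]
    rw [Finset.prod_range_succ, pow_succ (-1 : ℂ)]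
    rw [aq_odd] at h1 hne
    have hQ : q ^ (2 * m + 1) ≠ 0 := pow_ne_zero _ hq0
    generalize q ^ (2 * m + 1) = Q at *
    generalize q * (q ^ 2) ^ n = R at *
    have e' : R = 1 / Q := by field_simp; linear_combination e
    have : aqT q m = aqT q m * (-Q / (1 - -Q)) * (-(1 + R)) := by
      rw [e']
      field_simp
      ring
    rw [this]
    linear_combination (-(1 + R)) * h1

lemma aq_tsum (k : ℕ) (q : ℂ) (hq : IsPrimitiveRoot q k) (hk : Odd k) :
    ∑' n : ℕ, aqT q (n + 1) = (2 / 3) * ∑ n ∈ Finset.range k, aqT q (n + 1) := by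
  haveI : NeZero k := ⟨hk.pos.ne'⟩
  rw [← (Nat.divModEquiv k).symm.tsum_eq]
  have h1 : ∀ z : ℕ × Fin k, aqT q ((Nat.divModEquiv k).symm z + 1)
      = (-1 / 2 : ℂ) ^ z.1 * aqT q (z.2 + 1) := by
    intro z
    rw [← aqT_mul k q hq hk]
    congr 1
    simp [Nat.divModEquiv]
    ring
  simp_rw [h1]
  have hn : ‖(-1 / 2 : ℂ)‖ < 1 := by norm_num
  rw [← tsum_mul_tsum_of_summable_norm (f := fun a : ℕ => (-1 / 2 : ℂ) ^ a)
    (g := fun b : Fin k => aqT q (b + 1))]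
  · rw [tsum_geometric_of_norm_lt_one hn, tsum_fintype,
      Fin.sum_univ_eq_sum_range (fun b => aqT q (b + 1))]
    norm_num
  · simp_rw [norm_pow]
    exact summable_geometric_of_lt_one (norm_nonneg _) hn
  · exact (hasSum_fintype _).summable

theorem psi_antiquantum (k : ℕ) (q : ℂ) (hq : IsPrimitiveRoot q k) (hk : Odd k) :
    ∑' n : ℕ, (-q) ^ ((n + 1) ^ 2) /
        ∏ j ∈ Finset.range (n + 1), (1 - (-q) ^ (2 * j + 1)) =
      (1 / 3) * ∑ n ∈ Finset.range k,
        (∏ j ∈ Finset.range n, (1 + q ^ (2 * (j + 1)))) * (-q) ^ (n + 1) := by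
  have h1 := aq_tsum k q hq hk
  have h2 : 2 * ∑ n ∈ Finset.range k, aqT q (n + 1) = -aqG k (q ^ 2) q 1 := by
    rw [← Finset.sum_range_reflect, Finset.mul_sum, aqG, ← Finset.sum_neg_distrib]
    apply Finset.sum_congr rfl
    intro n hn
    have := Finset.mem_range.1 hn
    exact aqT_rev k q hq hk n _ (by omega)
  have h3 : ∑ n ∈ Finset.range k,
        (∏ j ∈ Finset.range n, (1 + q ^ (2 * (j + 1)))) * (-q) ^ (n + 1)
      = -(q * aqG k (q ^ 2) (q ^ 2) q) := by
    rw [aqG, Finset.mul_sum, ← Finset.sum_neg_distrib]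
    apply Finset.sum_congr rfl
    intro n _
    have : ∏ j ∈ Finset.range n, (1 + q ^ (2 * (j + 1)))
        = ∏ j ∈ Finset.range n, (1 + q ^ 2 * (q ^ 2) ^ j) := by
      apply Finset.prod_congr rfl
      intros
      ring
    rw [this]
    ring
  rw [h3, ← aq_main k q hq hk]
  unfold aqT at h1 h2
  rw [h1]
  linear_combination (1 / 3) * h2
end
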